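/- Let d ≥ 1, n ≥ 1 be integers and let x₁,…,x_n ∈ [0,1)^d. Let D = D(x₁,…,x_n) be the discrepancy and J = J(x₁,…,x_n) the isotropic discrepancy of the finite sequence (x₁,…,x_n). Then D(x₁,…,x_n) ≤ J(x₁,…,x_n) ≤ (4d√d + 1) · D(x₁,…,x_n)^{1/d}. -/

import Mathlib

open MeasureTheory Finset
open scoped Classical

/-- The discrepancy of a finite sequence `x₁, …, x_n` in `[0,1)^d`:
`sup_B | #{i : x_i ∈ B}/n − vol(B) |` over boxes `B = ∏ [a_i, b_i)` with
`0 ≤ a_i < b_i ≤ 1`. -/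
noncomputable def discrepancy {d n : ℕ} (x : Fin n → (Fin d → ℝ)) : ℝ :=
  sSup {r | ∃ a b : Fin d → ℝ, (∀ i, 0 ≤ a i ∧ a i < b i ∧ b i ≤ 1) ∧
    r = |((Finset.univ.filter (fun j => ∀ i, a i ≤ x j i ∧ x j i < b i)).card : ℝ) / n -
      ∏ i, (b i - a i)|}

/-- The isotropic discrepancy of a finite sequence `x₁, …, x_n` in `[0,1)^d`:
`sup_C | #{i : x_i ∈ C}/n − μ(C) |` over convex subsets `C ⊆ [0,1)^d`. -/
noncomputable def isoDiscrepancy {d n : ℕ} (x : Fin n → (Fin d → ℝ)) : ℝ :=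
  sSup {r | ∃ C : Set (Fin d → ℝ), Convex ℝ C ∧
    C ⊆ Set.pi Set.univ (fun _ => Set.Ico (0:ℝ) 1) ∧
    r = |((Finset.univ.filter (fun j => x j ∈ C)).card : ℝ) / n -
      (MeasureTheory.volume C).toReal|}

section helpers
open scoped Pointwise

lemma ioo_sub (S : Set ℝ) (hS : Convex ℝ S) (hne : S.Nonempty) : Set.Ioo (sInf S) (sSup S) ⊆ S := by
  intro a ha
  obtain ⟨u, hu, hua⟩ := exists_lt_of_csInf_lt hne ha.1
  obtain ⟨v, hv, hva⟩ := exists_lt_of_lt_csSup hne ha.2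
  exact hS.ordConnected.out hu hv ⟨hua.le, hva.le⟩

lemma fub {d : ℕ} (i : Fin (d+1)) (A B : Set (Fin (d+1) → ℝ)) (hA : MeasurableSet A)
    (hB : MeasurableSet B) (hA1 : A ⊆ Set.Icc 0 1) (c : ENNReal)
    (h : ∀ z : Fin d → ℝ, volume {a : ℝ | (i.insertNth a z : Fin (d+1) → ℝ) ∈ A} ≤
      volume {a : ℝ | (i.insertNth a z : Fin (d+1) → ℝ) ∈ B} + c) :
    volume A ≤ volume B + c := by
  have key : ∀ S : Set (Fin (d+1) → ℝ), MeasurableSet S → volume S =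
      ∫⁻ z : Fin d → ℝ, volume {a : ℝ | (i.insertNth a z : Fin (d+1) → ℝ) ∈ S} := by
    intro S hS
    have h1 := (volume_preserving_piFinSuccAbove (fun _ : Fin (d+1) => ℝ) i).symm
    rw [← h1.measure_preimage_equiv]
    have : MeasurableSet ((MeasurableEquiv.piFinSuccAbove (fun _ : Fin (d+1) => ℝ) i).symm ⁻¹' S) :=
      (MeasurableEquiv.measurable _) hS
    rw [Measure.volume_eq_prod, Measure.prod_apply_symm this]
    rfl
  have hm : ∀ S : Set (Fin (d+1) → ℝ), MeasurableSet S → Measurable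
      fun z : Fin d → ℝ => volume {a : ℝ | (i.insertNth a z : Fin (d+1) → ℝ) ∈ S} := by
    intro S hS
    have : MeasurableSet ((MeasurableEquiv.piFinSuccAbove (fun _ : Fin (d+1) => ℝ) i).symm ⁻¹' S) :=
      (MeasurableEquiv.measurable _) hS
    exact measurable_measure_prodMk_right this
  rw [key A hA, key B hB]
  have h1 : volume (Set.Icc (0 : Fin d → ℝ) 1) = 1 := by
    rw [Real.volume_Icc_pi]; simp
  calc _ ≤ ∫⁻ z : Fin d → ℝ, (volume {a : ℝ | (i.insertNth a z : Fin (d+1) → ℝ) ∈ B} +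
        (Set.Icc (0 : Fin d → ℝ) 1).indicator (fun _ => c) z) := by
        apply lintegral_mono
        intro z
        by_cases hz : z ∈ Set.Icc (0 : Fin d → ℝ) 1
        · simpa [hz] using h z
        · have : {a : ℝ | (i.insertNth a z : Fin (d+1) → ℝ) ∈ A} = ∅ := by
            ext a
            simp only [Set.mem_ofPred_eq, Set.mem_empty_iff_false, iff_false]
            intro ha
            apply hz
            have := hA1 ha
            constructor
            · intro j
              have := this.1 (i.succAbove j)
              simpa using this
            · intro j
              have := this.2 (i.succAbove j)
              simpa using this
          simp [this]
    _ = _ := by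
        rw [lintegral_add_left (hm B hB), lintegral_indicator_const measurableSet_Icc, h1, mul_one]

lemma oned_dil (S : Set ℝ) (T : Set ℝ) (hS : Convex ℝ S) (hb : Bornology.IsBounded S) (t : ℝ) (ht : 0 ≤ t)
    (hT : ∀ a ∈ T, ∃ s ∈ S, |a - s| ≤ t) : volume T ≤ volume S + ENNReal.ofReal (2*t) := by
  rcases S.eq_empty_or_nonempty with rfl | hne
  · have : T = ∅ := by
      ext a; simp; intro ha; simpa using hT a ha
    simp [this]
  have h1 := ioo_sub S hS hne
  have h2 : T ⊆ Set.Icc (sInf S - t) (sSup S + t) := by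
    intro a ha
    obtain ⟨s, hs, has⟩ := hT a ha
    have := csInf_le hb.bddBelow hs
    have := le_csSup hb.bddAbove hs
    rw [abs_le] at has
    constructor <;> linarith
  have h3 := (csInf_le hb.bddBelow hne.some_mem).trans (le_csSup hb.bddAbove hne.some_mem)
  calc volume T ≤ _ := measure_mono h2
    _ = ENNReal.ofReal (sSup S - sInf S) + ENNReal.ofReal (2*t) := by
      rw [Real.volume_Icc, ← ENNReal.ofReal_add (by linarith) (by linarith)]; congr 1; ring
    _ ≤ _ := by
      gcongr
      rw [← Real.volume_Ioo]
      exact measure_mono h1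

lemma oned_ero (S : Set ℝ) (T : Set ℝ) (hS : Convex ℝ S) (hb : Bornology.IsBounded S) (t : ℝ) (ht : 0 ≤ t)
    (hT : ∀ a, a + t ∈ S → a - t ∈ S → a ∈ T) : volume S ≤ volume T + ENNReal.ofReal (2*t) := by
  rcases S.eq_empty_or_nonempty with rfl | hne
  · simp
  have h1 := ioo_sub S hS hne
  have h2 : S ⊆ Set.Icc (sInf S) (sSup S) := fun s hs => ⟨csInf_le hb.bddBelow hs, le_csSup hb.bddAbove hs⟩
  have h4 : Set.Ioo (sInf S + t) (sSup S - t) ⊆ T := by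
    intro a ha
    apply hT
    · apply h1; constructor <;> linarith [ha.1, ha.2]
    · apply h1; constructor <;> linarith [ha.1, ha.2]
  calc volume S ≤ _ := measure_mono h2
    _ = ENNReal.ofReal ((sSup S - t - (sInf S + t)) + 2 * t) := by
      rw [Real.volume_Icc]; congr 1; ring
    _ ≤ ENNReal.ofReal (sSup S - t - (sInf S + t)) + ENNReal.ofReal (2*t) := ENNReal.ofReal_add_le
    _ ≤ _ := by
      gcongr
      rw [← Real.volume_Ioo]
      exact measure_mono h4

lemma sec_convex {d : ℕ} (i : Fin (d+1)) (A : Set (Fin (d+1) → ℝ)) (hA : Convex ℝ A) (z : Fin d → ℝ) :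
    Convex ℝ {a : ℝ | (i.insertNth a z : Fin (d+1) → ℝ) ∈ A} := by
  intro a ha b hb u v hu hv huv
  simp only [Set.mem_ofPred_eq] at *
  convert hA ha hb hu hv huv using 1
  ext j
  rcases Fin.eq_self_or_eq_succAbove i j with rfl | ⟨k, rfl⟩
  · simp
  · simp [← add_mul, huv]

lemma sec_bdd {d : ℕ} (i : Fin (d+1)) (A : Set (Fin (d+1) → ℝ)) (hA : A ⊆ Set.Icc 0 1) (z : Fin d → ℝ) :
    Bornology.IsBounded {a : ℝ | (i.insertNth a z : Fin (d+1) → ℝ) ∈ A} := by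
  apply (Metric.isBounded_Icc (0:ℝ) 1).subset
  intro a ha
  have := hA ha
  exact ⟨by simpa using this.1 i, by simpa using this.2 i⟩

lemma dil {d : ℕ} (C : Set (Fin (d+1) → ℝ)) (hC : Convex ℝ C) (hc : IsCompact C)
    (h1 : C ⊆ Set.Icc 0 1) (t : ℝ) (ht : 0 ≤ t) (s : Finset (Fin (d+1))) :
    ∃ F : Set (Fin (d+1) → ℝ), Convex ℝ F ∧ IsCompact F ∧ F ⊆ Set.Icc 0 1 ∧
      volume F ≤ volume C + s.card * ENNReal.ofReal (2*t) ∧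
      ∀ p ∈ C, ∀ q ∈ Set.Icc (0 : Fin (d+1) → ℝ) 1, (∀ i ∈ s, |q i - p i| ≤ t) → (∀ i ∉ s, q i = p i) → q ∈ F := by
  induction s using Finset.induction_on with
  | empty =>
    refine ⟨C, hC, hc, h1, by simp, ?_⟩
    intro p hp q hq _ h
    have : q = p := funext fun i => h i (by simp)
    rwa [this]
  | insert i s hi ih =>
    obtain ⟨F, hF, hFc, hF1, hv, hF2⟩ := ih
    let F' : Set (Fin (d+1) → ℝ) := (F + (fun σ : ℝ => (Pi.single i σ : Fin (d+1) → ℝ)) '' Set.Icc (-t) t) ∩ Set.Icc 0 1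
    have hcont : Continuous (fun σ : ℝ => (Pi.single i σ : Fin (d+1) → ℝ)) :=
      (LinearMap.single ℝ (fun _ : Fin (d+1) => ℝ) i).continuous_of_finiteDimensional
    have hF'c : IsCompact F' := (hFc.add (isCompact_Icc.image hcont)).inter_right isClosed_Icc
    refine ⟨F', ?_, hF'c, Set.inter_subset_right, ?_, ?_⟩
    · apply Convex.inter _ (convex_Icc _ _)
      apply hF.add
      exact (convex_Icc (-t) t).linear_image (LinearMap.single ℝ (fun _ : Fin (d+1) => ℝ) i)
    · have := fub i F' F hF'c.measurableSet hFc.measurableSet Set.inter_subset_right (ENNReal.ofReal (2*t)) ?_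
      · rw [Finset.card_insert_of_notMem hi]
        push_cast
        calc _ ≤ _ := this
          _ ≤ volume C + s.card * ENNReal.ofReal (2*t) + ENNReal.ofReal (2*t) := by gcongr
          _ = _ := by ring
      · intro z
        apply oned_dil _ _ (sec_convex i F hF z) (sec_bdd i F hF1 z) t ht
        rintro a ⟨⟨f, hf, _, ⟨σ, hσ, rfl⟩, he⟩, -⟩
        refine ⟨a - σ, ?_, ?_⟩
        · simp only [Set.mem_ofPred_eq]
          convert hf using 1
          ext j
          have hj := congrFun he j
          rcases Fin.eq_self_or_eq_succAbove i j with rfl | ⟨k, rfl⟩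
          · simp at hj ⊢; linarith
          · simp at hj ⊢; linarith
        · simp [abs_le]; exact hσ
    · intro p hp q hq h2 h3
      refine ⟨⟨Function.update q i (p i), ?_, _, ⟨q i - p i, ?_, rfl⟩, ?_⟩, hq⟩
      · apply hF2 p hp
        · constructor
          · intro j
            by_cases hj : j = i
            · subst hj; simpa using (h1 hp).1 j
            · simpa [hj] using hq.1 j
          · intro j
            by_cases hj : j = i
            · subst hj; simpa using (h1 hp).2 j
            · simpa [hj] using hq.2 j
        · intro j hj
          have : j ≠ i := fun h => hi (h ▸ hj)
          simpa [this] using h2 j (by simp [hj])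
        · intro j hj
          by_cases hji : j = i
          · subst hji; simp
          · simpa [hji] using h3 j (by simp [hj, hji])
      · have := h2 i (by simp)
        rwa [abs_le] at this
      · ext j
        by_cases hj : j = i
        · subst hj; simp
        · simp [hj]

lemma ero {d : ℕ} (C : Set (Fin (d+1) → ℝ)) (hC : Convex ℝ C) (hc : IsOpen C)
    (h1 : C ⊆ Set.Icc 0 1) (t : ℝ) (ht : 0 ≤ t) (s : Finset (Fin (d+1))) :
    ∃ F : Set (Fin (d+1) → ℝ), Convex ℝ F ∧ IsOpen F ∧ F ⊆ C ∧
      volume C ≤ volume F + s.card * ENNReal.ofReal (2*t) ∧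
      ∀ y ∈ F, ∀ q : (Fin (d+1) → ℝ), (∀ i ∈ s, |q i - y i| ≤ t) → (∀ i ∉ s, q i = y i) → q ∈ C := by
  induction s using Finset.induction_on with
  | empty =>
    refine ⟨C, hC, hc, subset_rfl, by simp, ?_⟩
    intro p hp q _ h
    have : q = p := funext fun i => h i (by simp)
    rwa [this]
  | insert i s hi ih =>
    obtain ⟨F, hF, hFc, hF1, hv, hF2⟩ := ih
    let F' : Set (Fin (d+1) → ℝ) := (fun y => y + Pi.single i t) ⁻¹' F ∩ (fun y => y + Pi.single i (-t)) ⁻¹' F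
    have hF'c : IsOpen F' := (hFc.preimage (by fun_prop)).inter (hFc.preimage (by fun_prop))
    have hmid : ∀ y ∈ F', ∀ σ : ℝ, |σ| ≤ t → y + Pi.single i σ ∈ F := by
      intro y hy σ hσ
      rw [abs_le] at hσ
      rcases eq_or_lt_of_le ht with rfl | ht
      · have : σ = 0 := by linarith
        subst this; simpa using hy.1
      · have := hF hy.1 hy.2 (a := (t + σ)/(2*t)) (b := (t-σ)/(2*t)) (div_nonneg (by linarith) (by linarith))
          (div_nonneg (by linarith) (by linarith)) (by field_simp; ring)
        convert this using 1
        ext j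
        by_cases hj : j = i
        · subst hj; simp; field_simp; ring
        · simp [hj]; field_simp; ring
    have hF'F : F' ⊆ F := fun y hy => by simpa using hmid y hy 0 (by simpa using ht)
    refine ⟨F', ?_, hF'c, hF'F.trans hF1, ?_, ?_⟩
    · exact (hF.translate_preimage_left _).inter (hF.translate_preimage_left _)
    · have := fub i F F' hFc.measurableSet hF'c.measurableSet (hF1.trans h1) (ENNReal.ofReal (2*t)) ?_
      · rw [Finset.card_insert_of_notMem hi]
        push_cast
        calc _ ≤ _ := hv
          _ ≤ volume F' + ENNReal.ofReal (2*t) + s.card * ENNReal.ofReal (2*t) := by gcongr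
          _ = _ := by ring
      · intro z
        apply oned_ero _ _ (sec_convex i F hF z) (sec_bdd i F (hF1.trans h1) z) t ht
        intro a ha hb
        constructor
        · simp only [Set.mem_preimage, Set.mem_ofPred_eq] at ha ⊢
          convert ha using 1
          ext j
          rcases Fin.eq_self_or_eq_succAbove i j with rfl | ⟨k, rfl⟩ <;> simp
        · simp only [Set.mem_preimage, Set.mem_ofPred_eq] at hb ⊢
          convert hb using 1
          ext j
          rcases Fin.eq_self_or_eq_succAbove i j with rfl | ⟨k, rfl⟩ <;> simp [sub_eq_add_neg]
    · intro y hy q h2 h3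
      apply hF2 (y + Pi.single i (q i - y i)) (hmid y hy _ (h2 i (by simp)))
      · intro j hj
        have : j ≠ i := fun h => hi (h ▸ hj)
        simpa [this] using h2 j (by simp [hj])
      · intro j hj
        by_cases hji : j = i
        · subst hji; simp
        · simpa [hji] using h3 j (by simp [hj, hji])

noncomputable def cnt {d n : ℕ} (x : Fin n → (Fin d → ℝ)) (U : Set (Fin d → ℝ)) : ℝ :=
  ((Finset.univ.filter (fun j => x j ∈ U)).card : ℝ) / n

lemma cnt_mono {d n : ℕ} (x : Fin n → (Fin d → ℝ)) {U V : Set (Fin d → ℝ)} (h : U ⊆ V) :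
    cnt x U ≤ cnt x V := by
  unfold cnt
  gcongr

lemma cnt_nonneg {d n : ℕ} (x : Fin n → (Fin d → ℝ)) (U : Set (Fin d → ℝ)) : 0 ≤ cnt x U := by
  unfold cnt; positivity

lemma cnt_le_one {d n : ℕ} (x : Fin n → (Fin d → ℝ)) (U : Set (Fin d → ℝ)) : cnt x U ≤ 1 := by
  unfold cnt
  apply div_le_one_of_le₀ _ (by positivity)
  exact_mod_cast (Finset.card_le_univ _).trans (by simp)

abbrev Qc (d : ℕ) : Set (Fin d → ℝ) := Set.pi Set.univ (fun _ => Set.Ico (0:ℝ) 1)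

abbrev bx {d : ℕ} (a b : Fin d → ℝ) : Set (Fin d → ℝ) := Set.pi Set.univ (fun i => Set.Ico (a i) (b i))

lemma vol_Qc (d : ℕ) : volume (Qc d) = 1 := by
  rw [Real.volume_pi_Ico]; simp

lemma vol_le_one {d : ℕ} {C : Set (Fin d → ℝ)} (h : C ⊆ Qc d) : volume C ≤ 1 :=
  (measure_mono h).trans (vol_Qc d).le

lemma vol_real_le_one {d : ℕ} {C : Set (Fin d → ℝ)} (h : C ⊆ Qc d) : (volume C).toReal ≤ 1 := by
  have := ENNReal.toReal_mono (by simp) (vol_le_one h)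
  simpa using this

lemma term_le_one {d n : ℕ} (x : Fin n → (Fin d → ℝ)) {C : Set (Fin d → ℝ)} (h : C ⊆ Qc d) :
    |cnt x C - (volume C).toReal| ≤ 1 := by
  have := vol_real_le_one h
  have := cnt_le_one x C
  have := cnt_nonneg x C
  have : 0 ≤ (volume C).toReal := ENNReal.toReal_nonneg
  rw [abs_le]; constructor <;> linarith

lemma bx_sub {d : ℕ} {a b : Fin d → ℝ} (h : ∀ i, 0 ≤ a i ∧ a i < b i ∧ b i ≤ 1) : bx a b ⊆ Qc d := by
  intro y hy i _
  have := hy i trivial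
  exact ⟨(h i).1.trans this.1, this.2.trans_le (h i).2.2⟩

lemma disc_term {d n : ℕ} (x : Fin n → (Fin d → ℝ)) {a b : Fin d → ℝ}
    (h : ∀ i, 0 ≤ a i ∧ a i < b i ∧ b i ≤ 1) :
    |((Finset.univ.filter (fun j => ∀ i, a i ≤ x j i ∧ x j i < b i)).card : ℝ) / n -
      ∏ i, (b i - a i)| = |cnt x (bx a b) - (volume (bx a b)).toReal| := by
  rw [Real.volume_pi_Ico_toReal (fun i => (h i).2.1.le)]
  unfold cnt
  simp [bx, Set.mem_pi]

lemma disc_bdd {d n : ℕ} (x : Fin n → (Fin d → ℝ)) :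
    ∀ r ∈ {r | ∃ a b : Fin d → ℝ, (∀ i, 0 ≤ a i ∧ a i < b i ∧ b i ≤ 1) ∧
    r = |((Finset.univ.filter (fun j => ∀ i, a i ≤ x j i ∧ x j i < b i)).card : ℝ) / n -
      ∏ i, (b i - a i)|}, r ≤ 1 := by
  rintro r ⟨a, b, h, rfl⟩
  rw [disc_term x h]
  exact term_le_one x (bx_sub h)

lemma iso_bdd {d n : ℕ} (x : Fin n → (Fin d → ℝ)) :
    ∀ r ∈ {r | ∃ C : Set (Fin d → ℝ), Convex ℝ C ∧
    C ⊆ Set.pi Set.univ (fun _ => Set.Ico (0:ℝ) 1) ∧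
    r = |((Finset.univ.filter (fun j => x j ∈ C)).card : ℝ) / n -
      (MeasureTheory.volume C).toReal|}, r ≤ 1 := by
  rintro r ⟨C, -, h, rfl⟩
  exact term_le_one x h

lemma box_le {d n : ℕ} (x : Fin n → (Fin d → ℝ)) {a b : Fin d → ℝ}
    (h : ∀ i, 0 ≤ a i ∧ a i < b i ∧ b i ≤ 1) :
    |cnt x (bx a b) - (volume (bx a b)).toReal| ≤ discrepancy x :=
  le_csSup ⟨1, disc_bdd x⟩ ⟨a, b, h, (disc_term x h).symm⟩

lemma disc_nonneg {d n : ℕ} (x : Fin n → (Fin d → ℝ)) : 0 ≤ discrepancy x :=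
  (abs_nonneg _).trans (box_le x (a := 0) (b := 1) (by simp))

lemma disc_le_one {d n : ℕ} (x : Fin n → (Fin d → ℝ)) : discrepancy x ≤ 1 :=
  csSup_le ⟨_, 0, 1, by simp, rfl⟩ (disc_bdd x)

lemma disc_le_iso {d n : ℕ} (x : Fin n → (Fin d → ℝ)) : discrepancy x ≤ isoDiscrepancy x := by
  unfold discrepancy
  refine csSup_le ⟨_, 0, 1, by simp, rfl⟩ ?_
  rintro r ⟨a, b, h, rfl⟩
  rw [disc_term x h]
  exact le_csSup ⟨1, iso_bdd x⟩ ⟨bx a b, convex_pi fun i _ => convex_Ico _ _, bx_sub h, rfl⟩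

def tube {d : ℕ} (r : ℕ) (κ : Fin d → Fin r) : Set (Fin (d+1) → ℝ) :=
  {y | ∀ j : Fin d, ⌊(r:ℝ) * y j.succ⌋₊ = κ j}

lemma floor_lt {r : ℕ} (hr : 1 ≤ r) {y : ℝ} (hy : y ∈ Set.Ico (0:ℝ) 1) : ⌊(r:ℝ) * y⌋₊ < r := by
  have : (0:ℝ) < r := by exact_mod_cast hr
  rw [Nat.floor_lt (mul_nonneg this.le hy.1)]
  nlinarith [hy.2]

lemma sum_tubes {d n r : ℕ} (hr : 1 ≤ r) (x : Fin n → (Fin (d+1) → ℝ))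
    (U : Set (Fin (d+1) → ℝ)) (hUQ : U ⊆ Qc (d+1))
    (hU : ∀ κ : Fin d → Fin r, U ∩ tube r κ = ∅ ∨ ∃ a b : Fin (d+1) → ℝ,
      (∀ i, 0 ≤ a i ∧ a i < b i ∧ b i ≤ 1) ∧ U ∩ tube r κ = bx a b) :
    |cnt x U - (volume U).toReal| ≤ (r:ℝ)^d * discrepancy x := by
  have hdisj : ∀ κ κ' : Fin d → Fin r, κ ≠ κ' → Disjoint (U ∩ tube r κ) (U ∩ tube r κ') := by
    intro κ κ' hne
    rw [Set.disjoint_left]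
    rintro y ⟨_, h1⟩ ⟨_, h2⟩
    apply hne
    funext j
    exact Fin.ext ((h1 j).symm.trans (h2 j))
  have hcov : U = ⋃ κ : Fin d → Fin r, U ∩ tube r κ := by
    ext y
    simp only [Set.mem_iUnion]
    constructor
    · intro hy
      exact ⟨fun j => ⟨_, floor_lt hr (hUQ hy j.succ trivial)⟩, hy, fun j => rfl⟩
    · rintro ⟨_, h, _⟩
      exact h
  have hmeas : ∀ κ : Fin d → Fin r, MeasurableSet (U ∩ tube r κ) := by
    intro κ
    rcases hU κ with h | ⟨a, b, -, h⟩
    · rw [h]; exact MeasurableSet.empty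
    · rw [h]; exact MeasurableSet.univ_pi fun i => measurableSet_Ico
  have hvol : (volume U).toReal = ∑ κ : Fin d → Fin r, (volume (U ∩ tube r κ)).toReal := by
    conv_lhs => rw [hcov]
    rw [measure_iUnion (fun κ κ' h => hdisj κ κ' h) hmeas, tsum_fintype, ENNReal.toReal_sum]
    intro κ _
    exact ((vol_le_one (Set.inter_subset_left.trans hUQ)).trans_lt (by simp)).ne
  have hcnt : cnt x U = ∑ κ : Fin d → Fin r, cnt x (U ∩ tube r κ) := by
    unfold cnt
    rw [← Finset.sum_div]
    congr 1
    rw [← Nat.cast_sum, ← Finset.card_biUnion]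
    · congr 2
      ext j
      conv_lhs => rw [hcov]
      simp
    · intro κ _ κ' _ hne
      refine Finset.disjoint_left.2 ?_
      intro j h1 h2
      simp only [Finset.mem_filter, Finset.mem_univ, true_and] at h1 h2
      exact Set.disjoint_left.1 (hdisj κ κ' hne) h1 h2
  rw [hvol, hcnt, ← Finset.sum_sub_distrib]
  calc _ ≤ ∑ κ : Fin d → Fin r, |cnt x (U ∩ tube r κ) - (volume (U ∩ tube r κ)).toReal| :=
        Finset.abs_sum_le_sum_abs _ _
    _ ≤ ∑ κ : Fin d → Fin r, discrepancy x := by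
        apply Finset.sum_le_sum
        intro κ _
        rcases hU κ with h | ⟨a, b, hab, h⟩
        · rw [h]; simpa [cnt] using disc_nonneg x
        · rw [h]; exact box_le x hab
    _ = _ := by simp

lemma tube_box {d r : ℕ} (hr : 1 ≤ r) (U : Set (Fin (d+1) → ℝ)) (hUQ : U ⊆ Qc (d+1))
    (κ : Fin d → Fin r)
    (hU : ∀ y ∈ U ∩ tube r κ, ∀ y' ∈ U ∩ tube r κ, ∀ z ∈ Qc (d+1) ∩ tube r κ,
      ⌊(r:ℝ) * y 0⌋₊ ≤ ⌊(r:ℝ) * z 0⌋₊ → ⌊(r:ℝ) * z 0⌋₊ ≤ ⌊(r:ℝ) * y' 0⌋₊ → z ∈ U) :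
    U ∩ tube r κ = ∅ ∨ ∃ a b : Fin (d+1) → ℝ,
      (∀ i, 0 ≤ a i ∧ a i < b i ∧ b i ≤ 1) ∧ U ∩ tube r κ = bx a b := by
  have hr0 : (0:ℝ) < r := by exact_mod_cast hr
  rcases Set.eq_empty_or_nonempty (U ∩ tube r κ) with h | hne
  · exact Or.inl h
  right
  let K : Set ℕ := (fun y : Fin (d+1) → ℝ => ⌊(r:ℝ) * y 0⌋₊) '' (U ∩ tube r κ)
  have hKne : K.Nonempty := hne.image _
  have hKr : ∀ k ∈ K, k < r := by
    rintro _ ⟨y, hy, rfl⟩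
    exact floor_lt hr (hUQ hy.1 0 trivial)
  have hKb : BddAbove K := ⟨r, fun k hk => (hKr k hk).le⟩
  have h1 := Nat.sInf_mem hKne
  have h2 := Nat.sSup_mem hKne hKb
  have h3 : sInf K ≤ sSup K := Nat.sInf_le h2
  have h4 := hKr _ h2
  obtain ⟨y1, hy1, e1⟩ := h1
  obtain ⟨y2, hy2, e2⟩ := h2
  simp only at e1 e2
  have flo : ∀ (y : ℝ) (m : ℕ), 0 ≤ y → (m ≤ ⌊(r:ℝ) * y⌋₊ ↔ (m:ℝ)/r ≤ y) := by
    intro y m hy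
    rw [Nat.le_floor_iff (by positivity), div_le_iff₀ hr0, mul_comm]
  have fhi : ∀ (y : ℝ) (m : ℕ), 0 ≤ y → (⌊(r:ℝ) * y⌋₊ ≤ m ↔ y < ((m:ℝ)+1)/r) := by
    intro y m hy
    rw [← Nat.lt_succ_iff, Nat.floor_lt (by positivity), lt_div_iff₀ hr0, mul_comm]
    push_cast; rfl
  refine ⟨Fin.cons ((sInf K : ℕ) / r : ℝ) (fun j => ((κ j : ℕ) / r : ℝ)),
    Fin.cons (((sSup K : ℕ) + 1) / r : ℝ) (fun j => (((κ j : ℕ) + 1) / r : ℝ)), ?_, ?_⟩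
  · intro i
    refine Fin.cases ?_ (fun j => ?_) i
    · simp only [Fin.cons_zero]
      refine ⟨by positivity, ?_, ?_⟩
      · gcongr
        have : ((sInf K : ℕ) : ℝ) ≤ (sSup K : ℕ) := by exact_mod_cast h3
        linarith
      · rw [div_le_one hr0]; exact_mod_cast h4
    · simp only [Fin.cons_succ]
      refine ⟨by positivity, ?_, ?_⟩
      · gcongr
        linarith
      · rw [div_le_one hr0]; exact_mod_cast (κ j).2
  · ext y
    constructor
    · intro hy i _
      refine Fin.cases ?_ (fun j => ?_) i
      · simp only [Fin.cons_zero]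
        have h0 := (hUQ hy.1 0 trivial).1
        have hm : ⌊(r:ℝ) * y 0⌋₊ ∈ K := ⟨y, hy, rfl⟩
        exact ⟨(flo _ _ h0).1 (Nat.sInf_le hm), (fhi _ _ h0).1 (le_csSup hKb hm)⟩
      · simp only [Fin.cons_succ]
        have h0 := (hUQ hy.1 j.succ trivial).1
        exact ⟨(flo _ _ h0).1 (hy.2 j).ge, (fhi _ _ h0).1 (hy.2 j).le⟩
    · intro hy
      have hy0 := hy 0 trivial
      simp only [Fin.cons_zero] at hy0
      have hys : ∀ j : Fin d, ((κ j : ℕ) / r : ℝ) ≤ y j.succ ∧ y j.succ < (((κ j : ℕ) + 1) / r : ℝ) := by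
        intro j
        have := hy j.succ trivial
        simp only [Fin.cons_succ] at this
        exact ⟨this.1, this.2⟩
      have n0 : 0 ≤ y 0 := le_trans (by positivity) hy0.1
      have ns : ∀ j : Fin d, 0 ≤ y j.succ := fun j => le_trans (by positivity) (hys j).1
      have ht : y ∈ tube r κ := fun j =>
        le_antisymm ((fhi _ _ (ns j)).2 (hys j).2) ((flo _ _ (ns j)).2 (hys j).1)
      refine ⟨hU y1 hy1 y2 hy2 y ⟨?_, ht⟩ ?_ ?_, ht⟩
      · intro i _
        refine Fin.cases ?_ (fun j => ?_) i
        · refine ⟨n0, hy0.2.trans_le ?_⟩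
          rw [div_le_one hr0]; exact_mod_cast h4
        · refine ⟨ns j, (hys j).2.trans_le ?_⟩
          rw [div_le_one hr0]; exact_mod_cast (κ j).2
      · rw [e1]; exact (flo _ _ n0).2 hy0.1
      · rw [e2]; exact (fhi _ _ n0).2 hy0.2

lemma floor_close {r : ℕ} (hr : 1 ≤ r) {u v : ℝ} (hu : 0 ≤ u) (hv : 0 ≤ v)
    (h : ⌊(r:ℝ) * u⌋₊ = ⌊(r:ℝ) * v⌋₊) : |u - v| ≤ 1 / r := by
  have hr0 : (0:ℝ) < r := by exact_mod_cast hr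
  have a1 := Nat.floor_le (mul_nonneg hr0.le hu)
  have a2 := Nat.lt_floor_add_one ((r:ℝ) * u)
  have b1 := Nat.floor_le (mul_nonneg hr0.le hv)
  have b2 := Nat.lt_floor_add_one ((r:ℝ) * v)
  rw [h] at a1 a2
  rw [le_div_iff₀ hr0, show |u - v| * (r:ℝ) = |(u - v) * r| by rw [abs_mul, abs_of_pos hr0], abs_le]
  constructor <;> nlinarith

lemma outer_case {d n r : ℕ} (hr : 1 ≤ r) (x : Fin n → (Fin (d+1) → ℝ))
    (C : Set (Fin (d+1) → ℝ)) (hC : Convex ℝ C) (hCQ : C ⊆ Qc (d+1)) :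
    cnt x C - (volume C).toReal ≤ (r:ℝ)^d * discrepancy x + 2 * (d+1) / r := by
  have hr0 : (0:ℝ) < r := by exact_mod_cast hr
  let O : Set (Fin (d+1) → ℝ) := {q | q ∈ Qc (d+1) ∧ ∃ p ∈ C, ∀ j, ⌊(r:ℝ) * q j⌋₊ = ⌊(r:ℝ) * p j⌋₊}
  have hOQ : O ⊆ Qc (d+1) := fun q hq => hq.1
  have hCO : C ⊆ O := fun q hq => ⟨hCQ hq, q, hq, fun _ => rfl⟩
  have h1 := sum_tubes hr x O hOQ (fun κ => tube_box hr O hOQ κ ?_)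
  · have hcl : closure C ⊆ Set.Icc 0 1 := by
      apply closure_minimal _ isClosed_Icc
      intro y hy
      exact ⟨fun i => (hCQ hy i trivial).1, fun i => (hCQ hy i trivial).2.le⟩
    obtain ⟨F, -, -, -, hv, hF⟩ := dil (closure C) hC.closure
      (isCompact_Icc.of_isClosed_subset isClosed_closure hcl) hcl (1/r) (by positivity) Finset.univ
    have hOF : O ⊆ F := by
      rintro q ⟨hq, p, hp, h⟩
      apply hF p (subset_closure hp) q ⟨fun i => (hq i trivial).1, fun i => (hq i trivial).2.le⟩
      · intro i _
        exact floor_close hr (hq i trivial).1 (hCQ hp i trivial).1 (h i)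
      · simp
    rw [measure_closure_of_null_frontier (hC.addHaar_frontier volume)] at hv
    have hv2 := (measure_mono hOF).trans hv
    have hCfin : volume C ≠ ⊤ := ((vol_le_one hCQ).trans_lt (by simp)).ne
    have hv3 := ENNReal.toReal_mono (by finiteness) hv2
    rw [ENNReal.toReal_add hCfin (by finiteness), ENNReal.toReal_mul, ENNReal.toReal_ofReal (by positivity)] at hv3
    simp only [Finset.card_univ, Fintype.card_fin, ENNReal.toReal_natCast] at hv3
    push_cast at hv3
    have hc := cnt_mono x hCO
    have := (abs_le.1 h1).2
    have e : ((d:ℝ)+1) * (2 * (1/r)) = 2 * (d+1) / r := by ring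
    linarith
  · rintro y ⟨⟨hyQ, p, hp, hyp⟩, hyt⟩ y' ⟨⟨hyQ', p', hp', hyp'⟩, hyt'⟩ z ⟨hzQ, hzt⟩ hle hle'
    rcases eq_or_lt_of_le hle with he | hlt
    · refine ⟨hzQ, p, hp, fun j => ?_⟩
      rw [← hyp j]
      refine Fin.cases he.symm (fun j => ?_) j
      rw [hzt j, hyt j]
    · set m := ⌊(r:ℝ) * z 0⌋₊ with hm
      rw [hyp 0] at hlt
      rw [hyp' 0] at hle'
      rw [Nat.floor_lt (mul_nonneg hr0.le (hCQ hp 0 trivial).1)] at hlt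
      rw [Nat.le_floor_iff (mul_nonneg hr0.le (hCQ hp' 0 trivial).1)] at hle'
      -- weights
      have hpp : 0 < r * p' 0 - r * p 0 := by linarith
      let v : ℝ := (m - r * p 0) / (r * p' 0 - r * p 0)
      have hv0 : 0 ≤ v := div_nonneg (by linarith) hpp.le
      have hv1 : v ≤ 1 := by rw [div_le_one hpp]; linarith
      have hw := hC hp hp' (a := 1 - v) (b := v) (by linarith) hv0 (by ring)
      refine ⟨hzQ, _, hw, fun j => ?_⟩
      refine Fin.cases ?_ (fun j => ?_) j
      · have : (r:ℝ) * ((1 - v) • p + v • p') 0 = m := by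
          have : v * (r * p' 0 - r * p 0) = m - r * p 0 := div_mul_cancel₀ _ hpp.ne'
          simp only [Pi.add_apply, Pi.smul_apply, smul_eq_mul]
          linarith
        rw [this, Nat.floor_natCast]
      · rw [hzt j]
        have f1 : ⌊(r:ℝ) * p j.succ⌋₊ = κ j := by rw [← hyp, hyt j]
        have f2 : ⌊(r:ℝ) * p' j.succ⌋₊ = κ j := by rw [← hyp', hyt' j]
        have n1 := mul_nonneg hr0.le (hCQ hp j.succ trivial).1
        have n2 := mul_nonneg hr0.le (hCQ hp' j.succ trivial).1
        rw [Nat.floor_eq_iff n1] at f1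
        rw [Nat.floor_eq_iff n2] at f2
        symm
        have e : (r:ℝ) * ((1 - v) • p + v • p') j.succ = (1-v) * (r * p j.succ) + v * (r * p' j.succ) := by
          simp only [Pi.add_apply, Pi.smul_apply, smul_eq_mul]; ring
        have cv := (convex_Ico ((κ j : ℕ) : ℝ) ((κ j : ℕ) + 1)) f1 f2 (a := 1 - v) (b := v) (by linarith) hv0 (by ring)
        simp only [smul_eq_mul] at cv
        rw [e, Nat.floor_eq_iff (by have := cv.1; exact le_trans (by positivity) this)]
        exact cv

lemma inner_case {d n r : ℕ} (hr : 1 ≤ r) (x : Fin n → (Fin (d+1) → ℝ))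
    (C : Set (Fin (d+1) → ℝ)) (hC : Convex ℝ C) (hCQ : C ⊆ Qc (d+1)) :
    (volume C).toReal - cnt x C ≤ (r:ℝ)^d * discrepancy x + 2 * (d+1) / r := by
  have hr0 : (0:ℝ) < r := by exact_mod_cast hr
  let O : Set (Fin (d+1) → ℝ) := {q | q ∈ Qc (d+1) ∧ ∀ p ∈ Qc (d+1), (∀ j, ⌊(r:ℝ) * p j⌋₊ = ⌊(r:ℝ) * q j⌋₊) → p ∈ C}
  have hOQ : O ⊆ Qc (d+1) := fun q hq => hq.1
  have hCO : O ⊆ C := fun q hq => hq.2 q hq.1 fun _ => rfl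
  have h1 := sum_tubes hr x O hOQ (fun κ => tube_box hr O hOQ κ ?_)
  · have hcl : interior C ⊆ Set.Icc 0 1 := by
      apply interior_subset.trans
      intro y hy
      exact ⟨fun i => (hCQ hy i trivial).1, fun i => (hCQ hy i trivial).2.le⟩
    obtain ⟨F, -, -, hFC, hv, hF⟩ := ero (interior C) hC.interior
      isOpen_interior hcl (1/r) (by positivity) Finset.univ
    have hOF : F ⊆ O := by
      intro q hq
      have hqQ := hCQ (interior_subset (hFC hq))
      refine ⟨hqQ, fun p hp h => interior_subset (hF q hq p ?_ (by simp))⟩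
      intro i _
      exact floor_close hr (hp i trivial).1 (hqQ i trivial).1 (h i)
    rw [measure_interior_of_null_frontier (hC.addHaar_frontier volume)] at hv
    have hOfin : volume O ≠ ⊤ := ((vol_le_one hOQ).trans_lt (by simp)).ne
    have hv2 := hv.trans (add_le_add_left (measure_mono hOF) _)
    have hv3 := ENNReal.toReal_mono (by finiteness) hv2
    rw [ENNReal.toReal_add hOfin (by finiteness), ENNReal.toReal_mul, ENNReal.toReal_ofReal (by positivity)] at hv3
    simp only [Finset.card_univ, Fintype.card_fin, ENNReal.toReal_natCast] at hv3
    push_cast at hv3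
    have hc := cnt_mono x hCO
    have := (abs_le.1 h1).1
    have e : ((d:ℝ)+1) * (2 * (1/r)) = 2 * (d+1) / r := by ring
    linarith
  · rintro y ⟨⟨hyQ, hy⟩, hyt⟩ y' ⟨⟨hyQ', hy'⟩, hyt'⟩ z ⟨hzQ, hzt⟩ hle hle'
    refine ⟨hzQ, fun p hp hpz => ?_⟩
    rw [← hpz 0] at hle hle'
    have hps : ∀ j : Fin d, ⌊(r:ℝ) * p j.succ⌋₊ = κ j := fun j => by rw [hpz, hzt j]
    have mono : ∀ u v : ℝ, u ≤ v → ⌊(r:ℝ) * u⌋₊ ≤ ⌊(r:ℝ) * v⌋₊ := fun u v h =>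
      Nat.floor_le_floor (by gcongr)
    rcases le_total (p 0) (y 0) with hc | hc
    · apply hy p hp
      intro j
      refine Fin.cases (le_antisymm (mono _ _ hc) hle) (fun j => ?_) j
      rw [hps j, hyt j]
    rcases le_total (y' 0) (p 0) with hc' | hc'
    · apply hy' p hp
      intro j
      refine Fin.cases (le_antisymm hle' (mono _ _ hc')) (fun j => ?_) j
      rw [hps j, hyt' j]
    have gen : ∀ w ∈ Qc (d+1), w ∈ tube r κ → (∀ q ∈ Qc (d+1), (∀ j, ⌊(r:ℝ) * q j⌋₊ = ⌊(r:ℝ) * w j⌋₊) → q ∈ C) →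
        Function.update p 0 (w 0) ∈ C := by
      intro w hwQ hwt hw
      apply hw
      · intro j _
        refine Fin.cases ?_ (fun j => ?_) j
        · simpa using hwQ 0 trivial
        · simpa using hp j.succ trivial
      · intro j
        refine Fin.cases ?_ (fun j => ?_) j
        · simp
        · simp [hps j, hwt j]
    have g1 := gen y hyQ hyt hy
    have g2 := gen y' hyQ' hyt' hy'
    have : p 0 ∈ segment ℝ (y 0) (y' 0) := by
      rw [segment_eq_Icc (hc.trans hc')]; exact ⟨hc, hc'⟩
    obtain ⟨a, b, ha, hb, hab, he⟩ := this
    convert hC g1 g2 ha hb hab using 1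
    funext j
    refine Fin.cases ?_ (fun j => ?_) j
    · simpa using he.symm
    · simp [← add_mul, hab]

end helpers

theorem discrepancy_le_isoDiscrepancy_le
    (d n : ℕ) (hd : 1 ≤ d) (hn : 1 ≤ n) (x : Fin n → (Fin d → ℝ))
    (hx : ∀ j, x j ∈ Set.pi Set.univ (fun _ => Set.Ico (0:ℝ) 1)) :
    discrepancy x ≤ isoDiscrepancy x ∧
      isoDiscrepancy x ≤ (4 * d * Real.sqrt d + 1) * (discrepancy x) ^ ((1 : ℝ) / d) := by
  refine ⟨disc_le_iso x, ?_⟩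
  obtain ⟨d, rfl⟩ : ∃ e, d = e + 1 := ⟨d - 1, by omega⟩
  unfold isoDiscrepancy
  refine csSup_le ⟨_, ∅, convex_empty, by simp, rfl⟩ ?_
  rintro s ⟨C, hC, hCQ, rfl⟩
  have main : ∀ r : ℕ, 1 ≤ r → |cnt x C - (volume C).toReal| ≤
      (r:ℝ)^d * discrepancy x + 2 * (d+1) / r := by
    intro r hr
    rw [abs_le]
    constructor
    · linarith [inner_case hr x C hC hCQ]
    · exact outer_case hr x C hC hCQ
  change |cnt x C - (volume C).toReal| ≤ _
  have hd0 : ((d + 1 : ℕ) : ℝ) ≠ 0 := by positivity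
  rcases eq_or_lt_of_le (disc_nonneg x) with h0 | hpos
  · rw [← h0, Real.zero_rpow (by positivity), mul_zero]
    apply le_of_forall_pos_le_add
    intro ε hε
    obtain ⟨r, hr⟩ := exists_nat_gt (2 * ((d:ℝ)+1) / ε)
    have hr0 : (0:ℝ) < r := lt_of_le_of_lt (by positivity) hr
    have := main r (by exact_mod_cast hr0)
    rw [← h0] at this
    have h2 : 2 * ((d:ℝ)+1) / r ≤ ε := by
      rw [div_lt_iff₀ hε] at hr
      rw [div_le_iff₀ hr0]; linarith
    linarith
  · set u := (discrepancy x) ^ ((1 : ℝ) / (d + 1 : ℕ)) with hu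
    have hu0 : 0 < u := Real.rpow_pos_of_pos hpos _
    have hu1 : u ≤ 1 := Real.rpow_le_one hpos.le (disc_le_one x) (by positivity)
    have hud : u ^ (d+1) = discrepancy x := by
      rw [hu, ← Real.rpow_natCast, ← Real.rpow_mul hpos.le, one_div_mul_cancel hd0, Real.rpow_one]
    have h1u : 1 ≤ 1 / u := by rw [le_div_iff₀ hu0]; linarith
    have hr : 1 ≤ ⌊1/u⌋₊ := by rw [Nat.le_floor_iff (by positivity)]; simpa using h1u
    have hm := main _ hr
    set r := ⌊1/u⌋₊
    have hr1 : (1:ℝ) ≤ r := by exact_mod_cast hr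
    have hr2 : (r:ℝ) ≤ 1/u := Nat.floor_le (by positivity)
    have hr3 : 1/u < r + 1 := Nat.lt_floor_add_one _
    have hru : r * u ≤ 1 := by rwa [le_div_iff₀ hu0] at hr2
    have hA : (r:ℝ)^d * discrepancy x ≤ u := by
      rw [← hud, pow_succ, ← mul_assoc, ← mul_pow]
      have : (r * u)^d ≤ 1 := pow_le_one₀ (by positivity) hru
      nlinarith
    have hB : 2 * ((d:ℝ)+1) / r ≤ 4 * (d+1) * u := by
      rw [div_lt_iff₀ hu0] at hr3
      rw [div_le_iff₀ (by linarith)]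
      have : 1 ≤ 2 * (r * u) := by nlinarith
      have hd1 : (0:ℝ) ≤ 2 * (d + 1) := by positivity
      nlinarith
    have hs : 1 ≤ Real.sqrt ((d+1 : ℕ) : ℝ) := by
      rw [Real.one_le_sqrt]; exact_mod_cast hd
    have hE : 4 * ((d:ℝ)+1) * u ≤ 4 * ((d+1 : ℕ):ℝ) * Real.sqrt ((d+1 : ℕ) : ℝ) * u := by
      apply mul_le_mul_of_nonneg_right _ hu0.le
      push_cast at hs ⊢
      exact le_mul_of_one_le_right (by positivity) hs
    calc _ ≤ _ := hm
      _ ≤ u + 4 * ((d+1 : ℕ):ℝ) * Real.sqrt ((d+1 : ℕ) : ℝ) * u := by linarith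
      _ = _ := by ring
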